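/- arXiv:2306.04381 — 2 statements merged into one kernel-verified Lean document; each statement's English description precedes it below -/
import Mathlib

section
/- Let H be a connected graded Hopf algebra with a natural growth operator ⊤. Let (u_i)_{i ∈ ℕ} be any family of linear maps u_i: P(H)^{⊗i} → P(H), and define the linear map Φ_{(u_i)} by Φ_{(u_i)}(1) = 1 and Φ_{(u_i)}(p_n ⊤ ⋯ ⊤ p_1) = Σ_{k=1}^{n} Σ_{a_1 + ⋯ + a_k = n} F_k((u_{a_1} ⊗ ⋯ ⊗ u_{a_k})(F_n^{−1}(p_n ⊤ ⋯ ⊤ p_1))). Then Φ_{(u_i)} is a coalgebra endomorphism of H. Conversely, every coalgebra endomorphism Φ of H is of the form Φ_{(u_i)} for some family (u_i)_{i ∈ ℕ}. -/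
open TensorProduct

section NaturalGrowthPrelude

variable (K H : Type*) [CommRing K] [Ring H] [HopfAlgebra K H]

/-- The reduced coproduct `Δ̂(x) = Δ(x) − x ⊗ 1 − 1 ⊗ x`. -/
noncomputable def reducedComul : H →ₗ[K] H ⊗[K] H :=
  Coalgebra.comul - (TensorProduct.mk K H H).flip 1 - TensorProduct.mk K H H 1

variable {K H}

/-- `⊤` is a natural growth operator: `Δ̂(x ⊤ y) = x ⊗ y + x⁽¹⁾ ⊗ (x⁽²⁾ ⊤ y)`
for all `x` and all primitive `y` (i.e. `Δ̂(y) = 0`). -/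
def IsNaturalGrowth (top : H →ₗ[K] H →ₗ[K] H) : Prop :=
  ∀ x y : H, reducedComul K H y = 0 →
    reducedComul K H (top x y) =
      x ⊗ₜ[K] y +
        (TensorProduct.map LinearMap.id (top.flip y)) (reducedComul K H x)

/-- A connected grading on a Hopf algebra, compatible with product and coproduct. -/
structure HopfGrading : Type _ where
  grade : ℕ → Submodule K H
  internal : DirectSum.IsInternal grade
  connected : grade 0 = (K ∙ (1 : H))
  mul_mem : ∀ {i j : ℕ} {x y : H}, x ∈ grade i → y ∈ grade j → x * y ∈ grade (i + j)
  comul_mem : ∀ (n : ℕ), ∀ x ∈ grade n,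
    Coalgebra.comul (R := K) x ∈
      ⨆ p : {p : ℕ × ℕ // p.1 + p.2 = n},
        LinearMap.range
          (TensorProduct.map (grade p.1.1).subtype (grade p.1.2).subtype)

/-- `nestAux top p a k = p_{a+k} ⊤ p_{a+k-1} ⊤ ⋯ ⊤ p_a` (left-nested:
`(p_{a+k} ⊤ ⋯ ⊤ p_{a+1}) ⊤ p_a`). -/
noncomputable def nestAux (top : H →ₗ[K] H →ₗ[K] H) (p : ℕ → H) : ℕ → ℕ → H
  | a, 0 => p a
  | a, k + 1 => top (nestAux top p (a + 1) k) (p a)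

/-- `nest top p a b = p_b ⊤ p_{b-1} ⊤ ⋯ ⊤ p_a` (for `a ≤ b`),
i.e. the iterated natural growth product `(p_b ⊤ ⋯ ⊤ p_{a+1}) ⊤ p_a`. -/
noncomputable def nest (top : H →ₗ[K] H →ₗ[K] H) (p : ℕ → H) (a b : ℕ) : H :=
  nestAux top p a (b - a)

end NaturalGrowthPrelude

/-!
STATEMENT 12: Let H be a connected graded Hopf algebra with a natural growth operator ⊤.
For any family of linear maps u_i : P(H)^{⊗i} → P(H), the map Φ_{(u_i)} defined by
Φ_{(u_i)}(1) = 1 and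
Φ_{(u_i)}(p_n ⊤ ⋯ ⊤ p_1) = Σ_{k=1}^n Σ_{a_1+⋯+a_k=n} F_k((u_{a_1} ⊗ ⋯ ⊗ u_{a_k})(F_n⁻¹(p_n ⊤ ⋯ ⊤ p_1)))
is a coalgebra endomorphism of H; conversely every coalgebra endomorphism of H is of
this form.
-/

universe u

section TensorPowers

variable (K : Type u) [Field K] (H : Type u) [Ring H] [HopfAlgebra K H]

/-- The submodule of primitive elements `P(H) = {x | Δ̂(x) = 0}`. -/
noncomputable def Prim : Submodule K H := LinearMap.ker (reducedComul K H)

/-- Left-nested tensor powers of the space of primitives: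
`PTP n = P(H)^{⊗(n+1)}`. -/
noncomputable def PTP : ℕ → ModuleCat K
  | 0 => ModuleCat.of K (Prim K H)
  | n + 1 => ModuleCat.of K ((PTP n : Type u) ⊗[K] (Prim K H))

variable {K H}

/-- `Fmap top n : P(H)^{⊗(n+1)} → H` sends the (left-nested) pure tensor
`p_{n+1} ⊗ ⋯ ⊗ p_1` to `p_{n+1} ⊤ ⋯ ⊤ p_1`; i.e. `Fmap top (i-1) = F_i`. -/
noncomputable def Fmap (top : H →ₗ[K] H →ₗ[K] H) :
    (n : ℕ) → (PTP K H n : Type u) →ₗ[K] H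
  | 0 => (Prim K H).subtype
  | n + 1 => TensorProduct.lift ((top ∘ₗ Fmap top n).compl₂ (Prim K H).subtype)

/-- `segT p a m = p_{a+m} ⊗ ⋯ ⊗ p_a ∈ P(H)^{⊗(m+1)}` (left-nested pure tensor of
a consecutive segment of the family `p`). -/
noncomputable def segT (p : ℕ → Prim K H) : ℕ → (m : ℕ) → (PTP K H m : Type u)
  | a, 0 => p a
  | a, m + 1 => (segT p (a + 1) m) ⊗ₜ[K] (p a)

/-- Left-nested iterated product: `nestList top x [y₁,…,y_k] = ((x ⊤ y₁) ⊤ ⋯) ⊤ y_k`. -/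
noncomputable def nestList (top : H →ₗ[K] H →ₗ[K] H) : H → List H → H
  | x, [] => x
  | x, y :: l => nestList top (top x y) l

/-- Left-nested iterated product of a list, `nestList' top [q₁,…,q_k] = q₁ ⊤ ⋯ ⊤ q_k`. -/
noncomputable def nestList' (top : H →ₗ[K] H →ₗ[K] H) : List H → H
  | [] => 0
  | x :: l => nestList top x l

/-- The defining equations of the coalgebra endomorphism `Φ_{(u_i)}` attached to a
family of maps `us m : P(H)^{⊗(m+1)} → P(H)` (so `us (i-1) = u_i`):
`Φ(1) = 1` and
`Φ(p_n ⊤ ⋯ ⊤ p_1) = Σ_{k=1}^{n} Σ_{a_1+⋯+a_k = n} F_k((u_{a_1} ⊗ ⋯ ⊗ u_{a_k})(F_n⁻¹(p_n ⊤ ⋯ ⊤ p_1)))`,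
where the inner sum is over all compositions of `n` and `(u_{a_1} ⊗ ⋯ ⊗ u_{a_k})`
acts on consecutive segments of `p_n ⊗ ⋯ ⊗ p_1 = F_n⁻¹(p_n ⊤ ⋯ ⊤ p_1)`. -/
def PhiEqns (top : H →ₗ[K] H →ₗ[K] H)
    (us : (m : ℕ) → (PTP K H m : Type u) →ₗ[K] Prim K H)
    (Φ : H →ₗ[K] H) : Prop :=
  Φ 1 = 1 ∧
  ∀ (n : ℕ) (p : ℕ → Prim K H),
    Φ (Fmap top n (segT p 1 n)) =
      ∑ c : Composition (n + 1),
        nestList' top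
          (List.ofFn fun i : Fin c.length =>
            ((us (c.blocksFun i - 1)
                (segT p ((n + 1) - c.sizeUpTo (i + 1) + 1) (c.blocksFun i - 1)) :
              Prim K H) : H))

/-- `Φ` is a coalgebra endomorphism of `H`. -/
def IsCoalgEndo (Φ : H →ₗ[K] H) : Prop :=
  (TensorProduct.map Φ Φ) ∘ₗ Coalgebra.comul (R := K) = Coalgebra.comul (R := K) ∘ₗ Φ ∧
  Coalgebra.counit (R := K) ∘ₗ Φ = Coalgebra.counit (R := K)

end TensorPowers

section Conilpotency

variable {K : Type u} [Field K] {H : Type u} [Ring H] [HopfAlgebra K H]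

theorem reducedComul_apply (x : H) :
    reducedComul K H x = Coalgebra.comul (R := K) x - x ⊗ₜ 1 - 1 ⊗ₜ x := rfl

theorem comul_eq_reducedComul (x : H) :
    Coalgebra.comul (R := K) x = reducedComul K H x + x ⊗ₜ 1 + 1 ⊗ₜ x := by
  rw [reducedComul_apply]; abel

theorem reducedComul_one : reducedComul K H 1 = -(1 ⊗ₜ 1) := by
  rw [reducedComul_apply, Bialgebra.comul_one, Algebra.TensorProduct.one_def]; abel

theorem rTensor_counit_reducedComul (x : H) :
    (Coalgebra.counit (R := K)).rTensor H (reducedComul K H x) =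
      -(Coalgebra.counit (R := K) x ⊗ₜ 1) := by
  rw [reducedComul_apply, map_sub, map_sub, Coalgebra.rTensor_counit_comul]
  simp

theorem reducedComul_coassoc (x : H) :
    TensorProduct.assoc K H H H ((reducedComul K H).rTensor H (reducedComul K H x)) =
      (reducedComul K H).lTensor H (reducedComul K H x) := by
  have hr (y : H ⊗[K] H) : TensorProduct.assoc K H H H ((reducedComul K H).rTensor H y) =
      TensorProduct.assoc K H H H ((Coalgebra.comul (R := K)).rTensor H y) -
        (TensorProduct.mk K H H 1).lTensor H y - 1 ⊗ₜ y := by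
    induction y with
    | zero => simp
    | add a b ha hb => simp only [map_add, ha, hb, TensorProduct.tmul_add]; abel
    | tmul a b => simp [reducedComul_apply, TensorProduct.sub_tmul]
  have hl (y : H ⊗[K] H) : (reducedComul K H).lTensor H y =
      (Coalgebra.comul (R := K)).lTensor H y - TensorProduct.assoc K H H H (y ⊗ₜ 1) -
        (TensorProduct.mk K H H 1).lTensor H y := by
    induction y with
    | zero => simp
    | add a b ha hb => simp only [map_add, ha, hb, TensorProduct.add_tmul]; abel
    | tmul a b => simp [reducedComul_apply, TensorProduct.tmul_sub]
  rw [hr, hl]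
  have key : TensorProduct.assoc K H H H
      ((Coalgebra.comul (R := K)).rTensor H (reducedComul K H x)) -
        1 ⊗ₜ reducedComul K H x =
      (Coalgebra.comul (R := K)).lTensor H (reducedComul K H x) -
        TensorProduct.assoc K H H H (reducedComul K H x ⊗ₜ 1) := by
    simp only [reducedComul_apply, map_sub, Coalgebra.coassoc_apply, LinearMap.rTensor_tmul,
      LinearMap.lTensor_tmul, TensorProduct.sub_tmul, TensorProduct.tmul_sub,
      TensorProduct.assoc_tmul, Bialgebra.comul_one, Algebra.TensorProduct.one_def]
    abel
  rw [sub_right_comm, key]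

theorem rTensor_mkQ_eq_zero_iff {M N : Type u} [AddCommGroup M] [Module K M] [AddCommGroup N]
    [Module K N] (C : Submodule K M) (z : M ⊗[K] N) :
    C.mkQ.rTensor N z = 0 ↔ ∃ w, C.subtype.rTensor N w = z :=
  rTensor_exact N (LinearMap.exact_subtype_mkQ C) C.mkQ_surjective z

theorem mem_Prim {x : H} : x ∈ Prim K H ↔ reducedComul K H x = 0 := Iff.rfl

/-- The conilpotency filtration: `C₀ = 0` and `C_{n+1} = {x | Δ̂(x) ∈ C_n ⊗ H}`. -/
noncomputable def conilFiltration (K H : Type u) [Field K] [Ring H] [HopfAlgebra K H] :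
    ℕ → Submodule K H
  | 0 => ⊥
  | n + 1 => LinearMap.ker ((conilFiltration K H n).mkQ.rTensor H ∘ₗ reducedComul K H)

theorem mem_conilFiltration_succ {n : ℕ} {x : H} :
    x ∈ conilFiltration K H (n + 1) ↔
      (conilFiltration K H n).mkQ.rTensor H (reducedComul K H x) = 0 := Iff.rfl

theorem rTensor_mkQ_eq_zero_of_le {M N : Type u} [AddCommGroup M] [Module K M] [AddCommGroup N]
    [Module K N] {C D : Submodule K M} (h : C ≤ D) {z : M ⊗[K] N}
    (hz : C.mkQ.rTensor N z = 0) : D.mkQ.rTensor N z = 0 := by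
  have : D.mkQ = C.mapQ D LinearMap.id h ∘ₗ C.mkQ := by ext; simp
  rw [this, LinearMap.rTensor_comp_apply, hz, map_zero]

theorem conilFiltration_mono : Monotone (conilFiltration K H) := by
  refine monotone_nat_of_le_succ fun n ↦ ?_
  induction n with
  | zero => exact bot_le
  | succ n ih => exact fun x hx ↦ rTensor_mkQ_eq_zero_of_le ih hx

theorem conilFiltration_le_ker_counit (n : ℕ) :
    conilFiltration K H n ≤ LinearMap.ker (Coalgebra.counit (R := K) (A := H)) := by
  induction n with
  | zero => exact bot_le
  | succ n ih =>
    intro x hx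
    rw [mem_conilFiltration_succ, rTensor_mkQ_eq_zero_iff] at hx
    obtain ⟨w, hw⟩ := hx
    have h := rTensor_counit_reducedComul (K := K) x
    have h0 : (Coalgebra.counit (R := K)).rTensor H (reducedComul K H x) = 0 := by
      rw [← hw, ← LinearMap.rTensor_comp_apply]
      have : (Coalgebra.counit (R := K) (A := H)) ∘ₗ (conilFiltration K H n).subtype = 0 :=
        LinearMap.ext fun y ↦ LinearMap.mem_ker.1 (ih y.2)
      rw [this, LinearMap.rTensor_zero, LinearMap.zero_apply]
    rw [h0, eq_comm, neg_eq_zero] at h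
    have h' := congrArg (fun t ↦ Coalgebra.counit (R := K) (TensorProduct.lid K H t)) h
    rw [LinearMap.mem_ker]
    simpa only [TensorProduct.lid_tmul, map_smul, Bialgebra.counit_one, smul_eq_mul, mul_one,
      map_zero] using h'

theorem conilFiltration_one : conilFiltration K H 1 = Prim K H := by
  ext x
  rw [mem_conilFiltration_succ, mem_Prim, rTensor_mkQ_eq_zero_iff]
  constructor
  · rintro ⟨w, hw⟩
    have : (conilFiltration K H 0).subtype = 0 := by
      ext y; exact (Submodule.mem_bot K).1 y.2
    rw [← hw, this, LinearMap.rTensor_zero, LinearMap.zero_apply]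
  · intro h
    exact ⟨0, by rw [h, map_zero]⟩

/-- A functional separating `y` shows that `mkQ x ⊗ y` vanishes only if `x ∈ C` or `y = 0`. -/
theorem mem_or_eq_zero_of_rTensor_mkQ_tmul {M N : Type u} [AddCommGroup M] [Module K M]
    [AddCommGroup N] [Module K N] {C : Submodule K M} {x : M} {y : N}
    (h : C.mkQ.rTensor N (x ⊗ₜ y) = 0) : x ∈ C ∨ y = 0 := by
  by_cases hy : y = 0
  · exact Or.inr hy
  obtain ⟨f, hf⟩ := Module.Projective.exists_dual_eq_one K hy
  have := congrArg (fun t ↦ TensorProduct.rid K _ (f.lTensor (M ⧸ C) t)) h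
  left
  simpa [hf] using this

namespace HopfGrading

variable (G : HopfGrading (K := K) (H := H))

/-- The projection of `H` onto its `n`-th graded component. -/
noncomputable def proj (n : ℕ) : H →ₗ[K] H :=
  (G.grade n).subtype ∘ₗ DirectSum.component K ℕ (fun i ↦ G.grade i) n ∘ₗ
    (LinearEquiv.ofBijective (DirectSum.coeLinearMap G.grade) G.internal).symm.toLinearMap

theorem proj_same {n : ℕ} {x : H} (hx : x ∈ G.grade n) : G.proj n x = x :=
  congrArg Subtype.val (G.internal.ofBijective_coeLinearMap_of_mem hx)

theorem proj_of_ne {m n : ℕ} (hmn : m ≠ n) {x : H} (hx : x ∈ G.grade m) : G.proj n x = 0 :=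
  congrArg Subtype.val (G.internal.ofBijective_coeLinearMap_of_mem_ne hmn hx)

theorem one_mem : (1 : H) ∈ G.grade 0 := by
  rw [G.connected]; exact Submodule.mem_span_singleton_self 1

theorem mem_grade_zero {x : H} (hx : x ∈ G.grade 0) : ∃ c : K, c • (1 : H) = x := by
  rw [G.connected] at hx; exact Submodule.mem_span_singleton.1 hx

theorem grade_le_conilFiltration (n : ℕ) : G.grade (n + 1) ≤ conilFiltration K H (n + 1) := by
  induction n using Nat.strong_induction_on with
  | _ n ih =>
  intro x hx
  rw [mem_conilFiltration_succ]
  let cut : H ⊗[K] H →ₗ[K] H ⊗[K] H :=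
    LinearMap.id
      - (TensorProduct.mk K H H).flip 1 ∘ₗ G.proj (n + 1) ∘ₗ
        (TensorProduct.rid K H).toLinearMap ∘ₗ (Coalgebra.counit (R := K)).lTensor H
      - TensorProduct.mk K H H 1 ∘ₗ G.proj (n + 1) ∘ₗ
        (TensorProduct.lid K H).toLinearMap ∘ₗ (Coalgebra.counit (R := K)).rTensor H
  have hcut : cut (Coalgebra.comul (R := K) x) = reducedComul K H x := by
    simp [cut, reducedComul_apply, G.proj_same hx]
  have hone : G.proj (n + 1) (1 : H) = 0 := G.proj_of_ne (by omega) G.one_mem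
  rw [← hcut]
  change _ ∈ LinearMap.ker ((conilFiltration K H n).mkQ.rTensor H ∘ₗ cut)
  refine Set.mem_of_subset_of_mem ?_ (G.comul_mem (n + 1) x hx)
  refine iSup_le (α := Submodule K (H ⊗[K] H)) ?_
  rintro ⟨⟨i, j⟩, hij⟩ _ ⟨w, rfl⟩
  rw [LinearMap.mem_ker]
  simp only at hij
  dsimp only at w ⊢
  induction w with
  | zero => simp
  | add a b ha hb => rw [map_add, map_add, ha, hb, add_zero]
  | tmul a b =>
    rw [TensorProduct.map_tmul, Submodule.subtype_apply, Submodule.subtype_apply,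
      LinearMap.comp_apply]
    rcases Nat.eq_zero_or_pos i with rfl | hi
    · obtain ⟨c, hc⟩ := G.mem_grade_zero a.2
      have hb : G.proj (n + 1) (b : H) = b := G.proj_same (by simp [← hij])
      have : cut ((a : H) ⊗ₜ (b : H)) = 0 := by
        simp [cut, ← hc, hone, hb, TensorProduct.smul_tmul]
      rw [this, map_zero]
    rcases Nat.eq_zero_or_pos j with rfl | hj
    · obtain ⟨c, hc⟩ := G.mem_grade_zero b.2
      have ha : G.proj (n + 1) (a : H) = a := G.proj_same (by simp [← hij])
      have : cut ((a : H) ⊗ₜ (b : H)) = 0 := by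
        simp [cut, ← hc, hone, ha]
      rw [this, map_zero]
    · have ha : G.proj (n + 1) (a : H) = 0 := G.proj_of_ne (by omega) a.2
      have hb : G.proj (n + 1) (b : H) = 0 := G.proj_of_ne (by omega) b.2
      have : cut ((a : H) ⊗ₜ (b : H)) = (a : H) ⊗ₜ (b : H) := by
        simp [cut, ha, hb]
      rw [this, LinearMap.rTensor_tmul]
      obtain ⟨k, rfl⟩ : ∃ k, i = k + 1 := ⟨i - 1, by omega⟩
      have : (a : H) ∈ conilFiltration K H n :=
        conilFiltration_mono (by omega) (ih k (by omega) a.2)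
      rw [Submodule.mkQ_apply, (Submodule.Quotient.mk_eq_zero _).2 this, TensorProduct.zero_tmul]

theorem exists_smul_one_add (G : HopfGrading (K := K) (H := H)) (x : H) :
    ∃ (c : K) (n : ℕ), ∃ y ∈ conilFiltration K H n, c • 1 + y = x := by
  have hx : x ∈ ⨆ n, G.grade n := by rw [G.internal.submodule_iSup_eq_top]; trivial
  induction hx using Submodule.iSup_induction' with
  | zero => exact ⟨0, 0, 0, zero_mem _, by simp⟩
  | mem i x hx =>
    cases i with
    | zero =>
      obtain ⟨c, rfl⟩ := G.mem_grade_zero hx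
      exact ⟨c, 0, 0, zero_mem _, by simp⟩
    | succ i => exact ⟨0, i + 1, x, G.grade_le_conilFiltration i hx, by simp⟩
  | add x y _ _ hx hy =>
    obtain ⟨c, m, x', hx', rfl⟩ := hx
    obtain ⟨d, n, y', hy', rfl⟩ := hy
    refine ⟨c + d, max m n, x' + y', add_mem (conilFiltration_mono (le_max_left _ _) hx')
      (conilFiltration_mono (le_max_right _ _) hy'), ?_⟩
    rw [add_smul]; abel

theorem exists_mem_conilFiltration (G : HopfGrading (K := K) (H := H)) {x : H}
    (hx : Coalgebra.counit (R := K) x = 0) : ∃ n, x ∈ conilFiltration K H n := by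
  obtain ⟨c, n, y, hy, rfl⟩ := G.exists_smul_one_add x
  have : Coalgebra.counit (R := K) y = 0 := conilFiltration_le_ker_counit n hy
  have hc : c = 0 := by simpa [this] using hx
  exact ⟨n, by simpa [hc] using hy⟩

end HopfGrading

theorem eq_zero_of_reducedComul_eq_tmul {n : ℕ} {x : H} (hx : x ∈ conilFiltration K H n)
    (h : reducedComul K H x = x ⊗ₜ x) : x = 0 := by
  induction n with
  | zero => exact (Submodule.mem_bot K).1 hx
  | succ n ih =>
    rw [mem_conilFiltration_succ, h] at hx
    exact (mem_or_eq_zero_of_rTensor_mkQ_tmul hx).elim ih id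

end Conilpotency

section Words

variable {K : Type u} [Field K] {H : Type u} [Ring H] [HopfAlgebra K H]

/-- The linear map `x ⊗ p ↦ x ⊤ p` for primitive `p`. -/
noncomputable def growthMap (top : H →ₗ[K] H →ₗ[K] H) : H ⊗[K] Prim K H →ₗ[K] H :=
  TensorProduct.lift (top.compl₂ (Prim K H).subtype)

theorem growthMap_tmul (top : H →ₗ[K] H →ₗ[K] H) (x : H) (p : Prim K H) :
    growthMap top (x ⊗ₜ p) = top x p := rfl

theorem Fmap_succ (top : H →ₗ[K] H →ₗ[K] H) (n : ℕ) (t : (PTP K H n : Type u) ⊗[K] Prim K H) :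
    Fmap top (n + 1) t = growthMap top ((Fmap top n).rTensor (Prim K H) t) := by
  induction t with
  | zero => simp only [map_zero]; exact map_zero (Fmap top (n + 1))
  | add a b ha hb =>
    simp only [map_add, ← ha, ← hb]
    exact map_add (Fmap top (n + 1)) a b
  | tmul a b => rfl

variable {top : H →ₗ[K] H →ₗ[K] H}

theorem rTensor_mkQ_reducedComul_growthMap (htop : IsNaturalGrowth top) {n : ℕ}
    {z : H ⊗[K] Prim K H}
    (hz : (conilFiltration K H (n + 1)).mkQ.rTensor (Prim K H) z = 0) :
    (conilFiltration K H n).mkQ.rTensor H (reducedComul K H (growthMap top z)) =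
      TensorProduct.map (conilFiltration K H n).mkQ (Prim K H).subtype z := by
  rw [rTensor_mkQ_eq_zero_iff] at hz
  obtain ⟨w, rfl⟩ := hz
  induction w with
  | zero => simp only [map_zero]
  | add a b ha hb => simp only [map_add, ha, hb]
  | tmul a b =>
    rw [LinearMap.rTensor_tmul, growthMap_tmul, htop _ _ b.2, map_add, LinearMap.rTensor_tmul,
      TensorProduct.map_tmul, Submodule.subtype_apply, Submodule.subtype_apply]
    have ha := mem_conilFiltration_succ.1 a.2
    have : (conilFiltration K H n).mkQ.rTensor H
        (TensorProduct.map LinearMap.id (top.flip b) (reducedComul K H a)) =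
        (top.flip b).lTensor _
          ((conilFiltration K H n).mkQ.rTensor H (reducedComul K H a)) := by
      generalize reducedComul K H (a : H) = t
      induction t with
      | zero => simp only [map_zero]
      | add a b ha hb => simp only [map_add, ha, hb]
      | tmul a b => rfl
    rw [this, ha, map_zero, add_zero]

theorem growthMap_mem_conilFiltration (htop : IsNaturalGrowth top) {n : ℕ}
    {z : H ⊗[K] Prim K H}
    (hz : (conilFiltration K H n).mkQ.rTensor (Prim K H) z = 0) :
    growthMap top z ∈ conilFiltration K H (n + 1) := by
  rw [mem_conilFiltration_succ, rTensor_mkQ_reducedComul_growthMap htop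
    (rTensor_mkQ_eq_zero_of_le (conilFiltration_mono n.le_succ) hz),
    ← LinearMap.lTensor_comp_rTensor, LinearMap.comp_apply, hz, map_zero]

theorem rTensor_mkQ_rTensor_Fmap {n : ℕ} {C : Submodule K H} (hC : ∀ s, Fmap top n s ∈ C)
    (t : (PTP K H n : Type u) ⊗[K] Prim K H) :
    C.mkQ.rTensor (Prim K H) ((Fmap top n).rTensor (Prim K H) t) = 0 := by
  have : C.mkQ ∘ₗ Fmap top n = 0 :=
    LinearMap.ext fun s ↦ (Submodule.Quotient.mk_eq_zero _).2 (hC s)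
  rw [← LinearMap.rTensor_comp_apply, this, LinearMap.rTensor_zero, LinearMap.zero_apply]

theorem Fmap_mem_conilFiltration (htop : IsNaturalGrowth top) (n : ℕ) (t : (PTP K H n : Type u)) :
    Fmap top n t ∈ conilFiltration K H (n + 1) := by
  induction n with
  | zero => rw [conilFiltration_one]; exact Subtype.property t
  | succ n ih =>
    exact (Fmap_succ top n t).symm ▸
      growthMap_mem_conilFiltration htop (rTensor_mkQ_rTensor_Fmap ih t)

theorem eq_zero_of_Fmap_mem_conilFiltration (htop : IsNaturalGrowth top) (n : ℕ)
    (t : (PTP K H n : Type u)) (ht : Fmap top n t ∈ conilFiltration K H n) : t = 0 := by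
  induction n with
  | zero => exact Subtype.ext ((Submodule.mem_bot K).1 ht)
  | succ n ih =>
    change (PTP K H n : Type u) ⊗[K] Prim K H at t
    have h := rTensor_mkQ_reducedComul_growthMap htop
      (rTensor_mkQ_rTensor_Fmap (Fmap_mem_conilFiltration htop n) t)
    rw [← Fmap_succ, mem_conilFiltration_succ.1 ht, ← LinearMap.comp_apply,
      LinearMap.map_comp_rTensor] at h
    refine (TensorProduct.map_injective_of_flat_flat
      ((conilFiltration K H n).mkQ ∘ₗ Fmap top n) (Prim K H).subtype ?_
      (Prim K H).injective_subtype) (h.symm.trans (map_zero _).symm)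
    refine (injective_iff_map_eq_zero _).2 fun s hs ↦ ih s ?_
    exact (Submodule.Quotient.mk_eq_zero _).1 hs

theorem top_mem_iSup_range {z : H} (hz : z ∈ ⨆ n, LinearMap.range (Fmap top n))
    (p : Prim K H) : top z p ∈ ⨆ n, LinearMap.range (Fmap top n) := by
  induction hz using Submodule.iSup_induction' with
  | zero => simp
  | add x y _ _ hx hy => simpa using add_mem hx hy
  | mem i x hx =>
    obtain ⟨t, rfl⟩ := hx
    exact Submodule.mem_iSup_of_mem (i + 1) ⟨t ⊗ₜ[K] p, rfl⟩

theorem conilFiltration_le_iSup_range (htop : IsNaturalGrowth top) (n : ℕ) :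
    conilFiltration K H n ≤ ⨆ n, LinearMap.range (Fmap top n) := by
  induction n with
  | zero => exact bot_le
  | succ n ih =>
  cases n with
  | zero =>
    rw [conilFiltration_one]
    exact fun x hx ↦ Submodule.mem_iSup_of_mem 0 ⟨⟨x, hx⟩, rfl⟩
  | succ n =>
    intro x hx
    set Q := (conilFiltration K H n).mkQ with hQ
    have hprim : (reducedComul K H).lTensor _ (Q.rTensor H (reducedComul K H x)) = 0 := by
      rw [mem_conilFiltration_succ, rTensor_mkQ_eq_zero_iff] at hx
      obtain ⟨w, hw⟩ := hx
      have h1 : (reducedComul K H).lTensor _ (Q.rTensor H (reducedComul K H x)) =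
          Q.rTensor _ ((reducedComul K H).lTensor H (reducedComul K H x)) := by
        generalize reducedComul K H x = y
        exact (LinearMap.congr_fun (LinearMap.lTensor_comp_rTensor ..) y).trans
          (LinearMap.congr_fun (LinearMap.rTensor_comp_lTensor ..) y).symm
      rw [h1, ← reducedComul_coassoc, ← hw]
      clear hw h1
      induction w with
      | zero => simp only [map_zero]
      | add a b ha hb => simp only [map_add, ha, hb, add_zero]
      | tmul a b =>
        have ha := mem_conilFiltration_succ.1 a.2
        have h2 (t : H ⊗[K] H) : Q.rTensor _ (TensorProduct.assoc K H H H (t ⊗ₜ b)) =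
            TensorProduct.assoc K _ H H (Q.rTensor H t ⊗ₜ b) := by
          induction t with
          | zero => simp only [TensorProduct.zero_tmul, map_zero]
          | add a b ha hb => simp only [map_add, TensorProduct.add_tmul, ha, hb]
          | tmul a b => rfl
        rw [LinearMap.rTensor_tmul, LinearMap.rTensor_tmul, h2, Submodule.subtype_apply, ha,
          TensorProduct.zero_tmul, map_zero]
    have hex : Function.Exact (Prim K H).subtype (reducedComul K H) :=
      LinearMap.exact_subtype_ker_map _
    obtain ⟨y, hy⟩ := (Module.Flat.lTensor_exact _ hex _).1 hprim
    obtain ⟨z, rfl⟩ := LinearMap.rTensor_surjective _ (conilFiltration K H n).mkQ_surjective y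
    have hz : TensorProduct.map Q (Prim K H).subtype z = Q.rTensor H (reducedComul K H x) := by
      rw [← hy, ← LinearMap.comp_apply, LinearMap.lTensor_comp_rTensor]
    have hz' : (conilFiltration K H (n + 1)).mkQ.rTensor (Prim K H) z = 0 := by
      apply Module.Flat.lTensor_preserves_injective_linearMap (M := H ⧸ conilFiltration K H (n + 1))
        (Prim K H).subtype (Prim K H).injective_subtype
      have hle : conilFiltration K H n ≤ conilFiltration K H (n + 1) :=
        conilFiltration_mono n.le_succ
      have hf : (conilFiltration K H (n + 1)).mkQ =
          (conilFiltration K H n).mapQ (conilFiltration K H (n + 1)) LinearMap.id hle ∘ₗ Q := by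
        ext; simp [hQ]
      rw [map_zero, ← LinearMap.comp_apply, LinearMap.lTensor_comp_rTensor, hf,
        ← LinearMap.rTensor_comp_map, LinearMap.comp_apply, hz, ← LinearMap.rTensor_comp_apply,
        ← hf]
      exact hx
    have hsub : x - growthMap top z ∈ conilFiltration K H (n + 1) := by
      rw [mem_conilFiltration_succ, map_sub, map_sub,
        rTensor_mkQ_reducedComul_growthMap htop hz', ← hQ, hz, sub_self]
    rw [← sub_add_cancel x (growthMap top z)]
    refine add_mem (ih hsub) ?_
    rw [rTensor_mkQ_eq_zero_iff (N := Prim K H)] at hz'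
    obtain ⟨w, rfl⟩ := hz'
    clear hsub hz hy
    induction w with
    | zero => simp
    | add a b ha hb => simpa using add_mem ha hb
    | tmul a b => exact top_mem_iSup_range (ih a.2) b

end Words

section Extension

variable {K : Type u} [Field K] {H : Type u} [Ring H] [HopfAlgebra K H]
  {top : H →ₗ[K] H →ₗ[K] H}

theorem directSum_eq_zero_of_toModule_Fmap_eq_zero (htop : IsNaturalGrowth top)
    {s : DirectSum ℕ fun n ↦ (PTP K H n : Type u)}
    (hs : DirectSum.toModule K ℕ H (Fmap top) s = 0) : s = 0 := by
  have key (N : ℕ) (hN : ∀ i, N ≤ i → s i = 0) : s = 0 := by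
    induction N with
    | zero => exact DFinsupp.ext fun i ↦ hN i (Nat.zero_le i)
    | succ N ih =>
      refine ih fun i hi ↦ ?_
      rcases hi.eq_or_lt with rfl | hi
      · have hdec : s = ∑ i ∈ Finset.range (N + 1),
            DirectSum.lof K ℕ (fun n ↦ (PTP K H n : Type u)) i (s i) := by
          refine DFinsupp.ext fun j ↦ ?_
          rw [DFinsupp.finsetSum_apply, Finset.sum_eq_single j]
          · exact (DirectSum.of_eq_same (β := fun n ↦ (PTP K H n : Type u)) j (s j)).symm
          · intro b _ hb
            exact DirectSum.of_eq_of_ne b j _ hb.symm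
          · intro hj
            rw [hN j (by simpa using hj), map_zero]; rfl
        rw [hdec, map_sum, Finset.sum_range_succ] at hs
        simp only [DirectSum.toModule_lof] at hs
        refine eq_zero_of_Fmap_mem_conilFiltration htop N _ ?_
        rw [eq_neg_of_add_eq_zero_right hs]
        refine neg_mem (sum_mem fun i hi ↦ ?_)
        exact conilFiltration_mono (Finset.mem_range.1 hi) (Fmap_mem_conilFiltration htop i _)
      · exact hN i hi
  classical
  refine key (s.support.sup id + 1) fun i hi ↦ ?_
  by_contra h
  have := Finset.le_sup (f := id) (DFinsupp.mem_support_iff.2 h)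
  simp only [id] at this
  omega

theorem counit_Fmap (htop : IsNaturalGrowth top) (n : ℕ) (t : (PTP K H n : Type u)) :
    Coalgebra.counit (R := K) (Fmap top n t) = 0 :=
  conilFiltration_le_ker_counit (n + 1) (Fmap_mem_conilFiltration htop n t)

theorem counit_eq_zero_iff_mem_iSup_range (G : HopfGrading (K := K) (H := H))
    (htop : IsNaturalGrowth top) {x : H} :
    Coalgebra.counit (R := K) x = 0 ↔ x ∈ ⨆ n, LinearMap.range (Fmap top n) := by
  constructor
  · intro hx
    obtain ⟨n, hn⟩ := G.exists_mem_conilFiltration hx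
    exact conilFiltration_le_iSup_range htop n hn
  · intro hx
    refine (iSup_le ?_ : _ ≤ LinearMap.ker (Coalgebra.counit (R := K) (A := H))) hx
    rintro n _ ⟨t, rfl⟩
    exact counit_Fmap htop n t

/-- Linear maps out of `H` may be prescribed freely on `1` and on the images of the `F_n`. -/
theorem exists_linearMap_extending (htop : IsNaturalGrowth top) {M : Type u} [AddCommGroup M]
    [Module K M] (m : M) (g : (n : ℕ) → (PTP K H n : Type u) →ₗ[K] M) :
    ∃ Φ : H →ₗ[K] M, Φ 1 = m ∧ ∀ n t, Φ (Fmap top n t) = g n t := by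
  let F := (LinearMap.toSpanSingleton K H 1).coprod (DirectSum.toModule K ℕ H (Fmap top))
  have hF : LinearMap.ker F = ⊥ := by
    refine LinearMap.ker_eq_bot'.2 ?_
    rintro ⟨c, s⟩ h
    have hε : Coalgebra.counit (R := K) (DirectSum.toModule K ℕ H (Fmap top) s) = 0 := by
      rw [← LinearMap.comp_apply]
      have : (Coalgebra.counit (R := K) (A := H)) ∘ₗ DirectSum.toModule K ℕ H (Fmap top) = 0 := by
        refine DirectSum.linearMap_ext K fun i ↦ LinearMap.ext fun t ↦ ?_
        simp only [LinearMap.comp_apply, DirectSum.toModule_lof, LinearMap.zero_apply]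
        exact counit_Fmap htop i t
      rw [this, LinearMap.zero_apply]
    have h' : c • (1 : H) + DirectSum.toModule K ℕ H (Fmap top) s = 0 := h
    have hc : c = 0 := by
      simpa [hε] using congrArg (Coalgebra.counit (R := K)) h'
    subst hc
    rw [zero_smul, zero_add] at h'
    rw [directSum_eq_zero_of_toModule_Fmap_eq_zero htop h', Prod.mk_zero_zero]
  obtain ⟨r, hr⟩ := F.exists_leftInverse_of_injective hF
  refine ⟨(LinearMap.toSpanSingleton K M m).coprod (DirectSum.toModule K ℕ M g) ∘ₗ r, ?_, ?_⟩
  · have : F (1, 0) = 1 := by simp [F]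
    rw [LinearMap.comp_apply, ← this, ← LinearMap.comp_apply r, hr]
    simp
  · intro n t
    have : F (0, DirectSum.lof K ℕ _ n t) = Fmap top n t := by simp [F]
    rw [LinearMap.comp_apply, ← this, ← LinearMap.comp_apply r, hr]
    simp

theorem mem_of_one_mem_of_Fmap_mem (G : HopfGrading (K := K) (H := H))
    (htop : IsNaturalGrowth top) {S : Submodule K H} (h1 : (1 : H) ∈ S)
    (hS : ∀ n t, Fmap top n t ∈ S) (x : H) : x ∈ S := by
  obtain ⟨c, n, y, hy, rfl⟩ := G.exists_smul_one_add x
  refine add_mem (S.smul_mem c h1) ?_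
  refine (iSup_le ?_ : _ ≤ S) (conilFiltration_le_iSup_range htop n hy)
  rintro n _ ⟨t, rfl⟩
  exact hS n t

theorem counit_top (G : HopfGrading (K := K) (H := H)) (htop : IsNaturalGrowth top) {x : H}
    (hx : Coalgebra.counit (R := K) x = 0) (p : Prim K H) :
    Coalgebra.counit (R := K) (top x p) = 0 :=
  (counit_eq_zero_iff_mem_iSup_range G htop).2
    (top_mem_iSup_range ((counit_eq_zero_iff_mem_iSup_range G htop).1 hx) p)

theorem segT_congr {p q : ℕ → Prim K H} {a : ℕ} (h : ∀ i, a ≤ i → p i = q i) (n : ℕ) :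
    segT p a n = segT q a n := by
  induction n generalizing a with
  | zero => exact h a le_rfl
  | succ n ih =>
    change segT p (a + 1) n ⊗ₜ[K] p a = segT q (a + 1) n ⊗ₜ[K] q a
    rw [ih fun i hi ↦ h i (by omega), h a le_rfl]

theorem linearMap_ext_segT {M : Type u} [AddCommGroup M] [Module K M] {n : ℕ} (a : ℕ)
    {f g : (PTP K H n : Type u) →ₗ[K] M} (h : ∀ p, f (segT p a n) = g (segT p a n)) : f = g := by
  induction n generalizing a M with
  | zero => exact LinearMap.ext fun t ↦ h fun _ ↦ t
  | succ n ih =>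
    change (PTP K H n : Type u) ⊗[K] Prim K H →ₗ[K] M at f g
    refine TensorProduct.ext' fun t q ↦ ?_
    refine LinearMap.congr_fun (ih (a + 1)
      (f := f ∘ₗ (TensorProduct.mk K (PTP K H n) (Prim K H)).flip q)
      (g := g ∘ₗ (TensorProduct.mk K (PTP K H n) (Prim K H)).flip q) fun p ↦ ?_) t
    have hp := h (Function.update p a q)
    change f (segT _ (a + 1) n ⊗ₜ _) = g (segT _ (a + 1) n ⊗ₜ _) at hp
    rw [Function.update_self, segT_congr (q := p)] at hp
    · exact hp
    · exact fun i hi ↦ Function.update_of_ne (by omega) _ _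

end Extension

section Compositions

theorem Composition.sum_blocks_succ {M : Type u} [AddCommMonoid M] (n : ℕ) (f : List ℕ → M) :
    ∑ c : Composition (n + 1), f c.blocks =
      f [n + 1] + ∑ j ∈ Finset.range n, ∑ c : Composition (n - 1 - j + 1),
        f (c.blocks ++ [j + 1]) := by
  have hsigma : ∑ c : Composition (n + 1), f c.blocks =
      ∑ j : Fin (n + 1), ∑ c : Composition (n - j), f (c.blocks ++ [(j : ℕ) + 1]) := by
    rw [← Fintype.sum_sigma' (fun (j : Fin (n + 1)) (c : Composition (n - j)) ↦
      f (c.blocks ++ [(j : ℕ) + 1]))]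
    symm
    let e : (Σ j : Fin (n + 1), Composition (n - j)) → Composition (n + 1) := fun x ↦
      ⟨x.2.blocks ++ [(x.1 : ℕ) + 1], by
        intro i hi
        rcases List.mem_append.1 hi with h | h
        · exact x.2.blocks_pos h
        · simp only [List.mem_singleton] at h; omega, by
        have := x.1.2
        simp only [List.sum_append, x.2.blocks_sum, List.sum_singleton]; omega⟩
    refine Fintype.sum_bijective e ⟨?_, ?_⟩ _ _ fun _ ↦ rfl
    · rintro ⟨⟨i, hi⟩, c⟩ ⟨⟨j, hj⟩, d⟩ h
      have h' := congrArg Composition.blocks h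
      obtain ⟨h1, h2⟩ := List.append_inj' h' rfl
      obtain rfl : i = j := by simpa using h2
      obtain rfl : c = d := Composition.ext h1
      rfl
    · intro c
      have hne : c.blocks ≠ [] := by rw [Ne, Composition.blocks_eq_nil]; omega
      have hcat := List.dropLast_append_getLast hne
      have hpos := c.blocks_pos (List.getLast_mem hne)
      have hsum := c.blocks_sum
      rw [← hcat, List.sum_append, List.sum_singleton] at hsum
      refine ⟨⟨⟨c.blocks.getLast hne - 1, by omega⟩, c.blocks.dropLast,
        fun hi ↦ c.blocks_pos (List.mem_of_mem_dropLast hi), ?_⟩, ?_⟩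
      · simp only; omega
      · refine Composition.ext ?_
        change c.blocks.dropLast ++ [c.blocks.getLast hne - 1 + 1] = c.blocks
        rw [Nat.sub_add_cancel hpos, hcat]
  have hzero (m : ℕ) (hm : m = 0) :
      ∑ c : Composition m, f (c.blocks ++ [n + 1]) = f [n + 1] := by
    subst hm
    have hb (c : Composition 0) : c.blocks = [] := c.blocks_eq_nil.2 rfl
    simp [hb, composition_card]
  have hcast (m m' : ℕ) (h : m = m') (k : ℕ) :
      ∑ c : Composition m, f (c.blocks ++ [k]) = ∑ c : Composition m', f (c.blocks ++ [k]) := by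
    subst h; rfl
  rw [hsigma, Fin.sum_univ_eq_sum_range
    (fun j ↦ ∑ c : Composition (n - j), f (c.blocks ++ [j + 1])), Finset.sum_range_succ,
    hzero _ (Nat.sub_self n), add_comm]
  congr 1
  refine Finset.sum_congr rfl fun j hj ↦ hcast _ _ ?_ _
  have := Finset.mem_range.1 hj
  omega

end Compositions

section BlockWords

variable {K : Type u} [Field K] {H : Type u} [Ring H] [HopfAlgebra K H]

theorem nestList_append (top : H →ₗ[K] H →ₗ[K] H) (x : H) (l : List H) (y : H) :
    nestList top x (l ++ [y]) = top (nestList top x l) y := by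
  induction l generalizing x with
  | nil => rfl
  | cons z l ih => exact ih (top x z)

theorem nestList'_append (top : H →ₗ[K] H →ₗ[K] H) {l : List H} (hl : l ≠ []) (y : H) :
    nestList' top (l ++ [y]) = top (nestList' top l) y := by
  cases l with
  | nil => exact absurd rfl hl
  | cons x l => exact nestList_append top x l y

/-- The values of `us` on consecutive segments of `p`, of lengths given by the list and laid out
from index `a` upwards starting with the last block. -/
noncomputable def blockVals (us : (m : ℕ) → (PTP K H m : Type u) →ₗ[K] Prim K H)
    (p : ℕ → Prim K H) (a : ℕ) : List ℕ → List H
  | [] => []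
  | b :: l => (us (b - 1) (segT p (a + l.sum) (b - 1)) : H) :: blockVals us p a l

variable (us : (m : ℕ) → (PTP K H m : Type u) →ₗ[K] Prim K H)

theorem blockVals_append (p : ℕ → Prim K H) (a : ℕ) (l : List ℕ) (b : ℕ) :
    blockVals us p a (l ++ [b]) =
      blockVals us p (a + b) l ++ [(us (b - 1) (segT p a (b - 1)) : H)] := by
  induction l with
  | nil => rfl
  | cons c l ih =>
    simp only [List.cons_append, blockVals, ih, List.sum_append, List.sum_singleton]
    rw [show a + (l.sum + b) = a + b + l.sum by omega]

theorem blockVals_eq_ofFn (p : ℕ → Prim K H) (a : ℕ) (l : List ℕ) :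
    blockVals us p a l = List.ofFn fun i : Fin l.length ↦
      (us (l[i] - 1) (segT p (a + (l.drop (i + 1)).sum) (l[i] - 1)) : H) := by
  induction l with
  | nil => rfl
  | cons b l ih => rw [List.ofFn_succ, blockVals, ih]; rfl

theorem ofFn_composition_eq_blockVals (p : ℕ → Prim K H) {n : ℕ} (c : Composition n) :
    (List.ofFn fun i : Fin c.length ↦
      ((us (c.blocksFun i - 1) (segT p (n - c.sizeUpTo (i + 1) + 1) (c.blocksFun i - 1)) :
        Prim K H) : H)) = blockVals us p 1 c.blocks := by
  rw [blockVals_eq_ofFn]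
  refine congrArg List.ofFn (funext fun i ↦ ?_)
  have h := List.sum_take_add_sum_drop c.blocks (i + 1)
  rw [c.blocks_sum] at h
  have : n - c.sizeUpTo (i + 1) + 1 = 1 + (c.blocks.drop (i + 1)).sum := by
    rw [Composition.sizeUpTo]; omega
  rw [this]
  rfl

theorem blockVals_ne_nil (p : ℕ → Prim K H) (a : ℕ) {l : List ℕ} (hl : l ≠ []) :
    blockVals us p a l ≠ [] := by
  cases l with
  | nil => exact absurd rfl hl
  | cons b l => exact List.cons_ne_nil _ _

/-- The sum over all compositions of `n + 1` of the growth products of the values of `us` on the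
blocks of the word `p_{a+n} ⋯ p_a`. -/
noncomputable def blockWord (top : H →ₗ[K] H →ₗ[K] H) (p : ℕ → Prim K H) (a n : ℕ) : H :=
  ∑ c : Composition (n + 1), nestList' top (blockVals us p a c.blocks)

theorem blockWord_eq (top : H →ₗ[K] H →ₗ[K] H) (p : ℕ → Prim K H) (a n : ℕ) :
    blockWord us top p a n = us n (segT p a n) +
      ∑ j ∈ Finset.range n,
        top (blockWord us top p (a + j + 1) (n - 1 - j)) (us j (segT p a j)) := by
  rw [blockWord, Composition.sum_blocks_succ n fun l ↦ nestList' top (blockVals us p a l)]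
  congr 1
  refine Finset.sum_congr rfl fun j _ ↦ ?_
  rw [blockWord, map_sum, LinearMap.sum_apply]
  refine Finset.sum_congr rfl fun c _ ↦ ?_
  rw [blockVals_append, nestList'_append]
  · rfl
  · refine blockVals_ne_nil us p _ ?_
    rw [Ne, Composition.blocks_eq_nil]
    omega

theorem exists_linearMap_segT_segT {M : Type u} [AddCommGroup M] [Module K M] (m j : ℕ)
    (B : (PTP K H m : Type u) →ₗ[K] (PTP K H j : Type u) →ₗ[K] M) :
    ∃ L : (PTP K H (m + j + 1) : Type u) →ₗ[K] M, ∀ p a,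
      L (segT p a (m + j + 1)) = B (segT p (a + j + 1) m) (segT p a j) := by
  induction j generalizing M with
  | zero => exact ⟨TensorProduct.lift B, fun p a ↦ rfl⟩
  | succ j ih =>
    obtain ⟨L, hL⟩ := ih (M := Prim K H →ₗ[K] M)
      ((TensorProduct.lcurry (.id K) (PTP K H j) (Prim K H) M) ∘ₗ B)
    refine ⟨TensorProduct.lift L, fun p a ↦ ?_⟩
    change L (segT p (a + 1) (m + j + 1)) (p a) = _
    rw [hL, show a + 1 + j + 1 = a + (j + 1) + 1 by omega]
    rfl

theorem exists_linearMap_blockWord (top : H →ₗ[K] H →ₗ[K] H) (n : ℕ) :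
    ∃ L : (PTP K H n : Type u) →ₗ[K] H, ∀ p a, L (segT p a n) = blockWord us top p a n := by
  induction n using Nat.strong_induction_on with
  | _ n ih =>
  have step (j : ℕ) (hj : j < n) : ∃ L : (PTP K H n : Type u) →ₗ[K] H, ∀ p a,
      L (segT p a n) =
        top (blockWord us top p (a + j + 1) (n - 1 - j)) (us j (segT p a j)) := by
    obtain ⟨m, rfl⟩ : ∃ m, n = m + j + 1 := ⟨n - 1 - j, by omega⟩
    obtain ⟨L, hL⟩ := ih m (by omega)
    obtain ⟨L', hL'⟩ := exists_linearMap_segT_segT m j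
      ((top ∘ₗ L).compl₂ ((Prim K H).subtype ∘ₗ us j))
    refine ⟨L', fun p a ↦ ?_⟩
    rw [hL', show m + j + 1 - 1 - j = m by omega, ← hL]
    rfl
  choose L hL using step
  refine ⟨(Prim K H).subtype ∘ₗ us n +
    ∑ j : Fin n, L j j.2, fun p a ↦ ?_⟩
  rw [blockWord_eq, Finset.sum_range, LinearMap.add_apply, LinearMap.sum_apply]
  congr 1
  exact Finset.sum_congr rfl fun j _ ↦ hL j j.2 p a

end BlockWords

section Endomorphisms

variable {K : Type u} [Field K] {H : Type u} [Ring H] [HopfAlgebra K H]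
  {top : H →ₗ[K] H →ₗ[K] H}

theorem reducedComul_Fmap_segT (htop : IsNaturalGrowth top) (p : ℕ → Prim K H) (a n : ℕ) :
    reducedComul K H (Fmap top n (segT p a n)) =
      ∑ k ∈ Finset.range n,
        Fmap top (n - 1 - k) (segT p (a + k + 1) (n - 1 - k)) ⊗ₜ Fmap top k (segT p a k) := by
  induction n generalizing a with
  | zero => exact (p a).2
  | succ n ih =>
    have hF (b k : ℕ) : Fmap top (k + 1) (segT p b (k + 1)) =
      top (Fmap top k (segT p (b + 1) k)) (p b) := rfl
    rw [hF, htop _ _ (p a).2, ih, map_sum, Finset.sum_range_succ', add_comm]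
    congr 1
    refine Finset.sum_congr rfl fun k _ ↦ ?_
    rw [TensorProduct.map_tmul, hF, show n + 1 - 1 - (k + 1) = n - 1 - k by omega,
      show a + (k + 1) + 1 = a + 1 + k + 1 by omega]
    rfl

theorem reducedComul_blockWord (htop : IsNaturalGrowth top)
    (us : (m : ℕ) → (PTP K H m : Type u) →ₗ[K] Prim K H) (p : ℕ → Prim K H) (a n : ℕ) :
    reducedComul K H (blockWord us top p a n) =
      ∑ k ∈ Finset.range n,
        blockWord us top p (a + k + 1) (n - 1 - k) ⊗ₜ blockWord us top p a k := by
  induction n using Nat.strong_induction_on generalizing a with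
  | _ n ih =>
  have hL (j : ℕ) (hj : j ∈ Finset.range n) :
      reducedComul K H
          (top (blockWord us top p (a + j + 1) (n - 1 - j)) (us j (segT p a j))) =
        blockWord us top p (a + j + 1) (n - 1 - j) ⊗ₜ (us j (segT p a j) : H) +
          ∑ i ∈ Finset.range (n - 1 - j),
            blockWord us top p (a + j + 1 + i + 1) (n - 1 - j - 1 - i) ⊗ₜ
              top (blockWord us top p (a + j + 1) i) (us j (segT p a j)) := by
    have := Finset.mem_range.1 hj
    rw [htop _ _ (us j (segT p a j)).2, ih _ (by omega), map_sum]
    rfl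
  have hR (k : ℕ) : blockWord us top p (a + k + 1) (n - 1 - k) ⊗ₜ[K] blockWord us top p a k =
      blockWord us top p (a + k + 1) (n - 1 - k) ⊗ₜ (us k (segT p a k) : H) +
        ∑ j ∈ Finset.range k, blockWord us top p (a + k + 1) (n - 1 - k) ⊗ₜ
          top (blockWord us top p (a + j + 1) (k - 1 - j)) (us j (segT p a j)) := by
    rw [blockWord_eq us top p a k, TensorProduct.tmul_add, TensorProduct.tmul_sum]
  rw [blockWord_eq, map_add, mem_Prim.1 (us n (segT p a n)).2, zero_add, map_sum,
    Finset.sum_congr rfl hL, Finset.sum_congr rfl fun k _ ↦ hR k, Finset.sum_add_distrib,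
    Finset.sum_add_distrib, Finset.sum_sigma', Finset.sum_sigma']
  congr 1
  refine Finset.sum_nbij' (fun x ↦ ⟨x.1 + x.2 + 1, x.1⟩) (fun x ↦ ⟨x.2, x.1 - 1 - x.2⟩)
    ?_ ?_ ?_ ?_ ?_
  · rintro ⟨j, i⟩ h
    simp only [Finset.mem_sigma, Finset.mem_range] at h ⊢
    omega
  · rintro ⟨k, j⟩ h
    simp only [Finset.mem_sigma, Finset.mem_range] at h ⊢
    omega
  · rintro ⟨j, i⟩ h
    simp only [Sigma.mk.injEq, heq_eq_eq, true_and]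
    omega
  · rintro ⟨k, j⟩ h
    simp only [Finset.mem_sigma, Finset.mem_range] at h
    simp only [Sigma.mk.injEq, heq_eq_eq, and_true]
    omega
  · rintro ⟨j, i⟩ h
    simp only
    rw [show a + j + 1 + i + 1 = a + (j + i + 1) + 1 by omega,
      show n - 1 - j - 1 - i = n - 1 - (j + i + 1) by omega,
      show j + i + 1 - 1 - j = i by omega]

theorem counit_blockWord (G : HopfGrading (K := K) (H := H)) (htop : IsNaturalGrowth top)
    (us : (m : ℕ) → (PTP K H m : Type u) →ₗ[K] Prim K H) (p : ℕ → Prim K H) (a n : ℕ) :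
    Coalgebra.counit (R := K) (blockWord us top p a n) = 0 := by
  induction n using Nat.strong_induction_on generalizing a with
  | _ n ih =>
  rw [blockWord_eq, map_add, map_sum, Finset.sum_eq_zero, add_zero]
  · exact counit_Fmap htop 0 (us n (segT p a n))
  · intro j hj
    have := Finset.mem_range.1 hj
    exact counit_top G htop (ih _ (by omega) _) _

theorem map_reducedComul_iff {Φ : H →ₗ[K] H} (h1 : Φ 1 = 1) (x : H) :
    TensorProduct.map Φ Φ (reducedComul K H x) = reducedComul K H (Φ x) ↔
      TensorProduct.map Φ Φ (Coalgebra.comul (R := K) x) = Coalgebra.comul (R := K) (Φ x) := by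
  rw [comul_eq_reducedComul x, comul_eq_reducedComul (Φ x)]
  simp [h1]

theorem exists_isCoalgEndo_blockWord (G : HopfGrading (K := K) (H := H))
    (htop : IsNaturalGrowth top) (us : (m : ℕ) → (PTP K H m : Type u) →ₗ[K] Prim K H) :
    ∃ Φ : H →ₗ[K] H, Φ 1 = 1 ∧
      (∀ n p a, Φ (Fmap top n (segT p a n)) = blockWord us top p a n) ∧ IsCoalgEndo Φ := by
  choose g hg using exists_linearMap_blockWord us top
  obtain ⟨Φ, h1, hΦ⟩ := exists_linearMap_extending htop 1 g
  have hW (n : ℕ) (p : ℕ → Prim K H) (a : ℕ) :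
      Φ (Fmap top n (segT p a n)) = blockWord us top p a n := by rw [hΦ, hg]
  have hext {M : Type u} [AddCommGroup M] [Module K M] {f f' : H →ₗ[K] M} (hf : f 1 = f' 1)
      (h : ∀ n p, f (Fmap top n (segT p 0 n)) = f' (Fmap top n (segT p 0 n))) : f = f' :=
    LinearMap.ext <| mem_of_one_mem_of_Fmap_mem G htop (S := LinearMap.eqLocus f f') hf
      fun n ↦ LinearMap.congr_fun (f := f ∘ₗ Fmap top n) (g := f' ∘ₗ Fmap top n)
        (linearMap_ext_segT 0 (h n))
  refine ⟨Φ, h1, hW, hext ?_ fun n p ↦ ?_, hext ?_ fun n p ↦ ?_⟩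
  · simp [h1, Algebra.TensorProduct.one_def]
  · refine (map_reducedComul_iff h1 _).1 ?_
    rw [reducedComul_Fmap_segT htop, map_sum, hW, reducedComul_blockWord htop]
    simp only [TensorProduct.map_tmul, hW]
  · simp [h1]
  · rw [LinearMap.comp_apply, hW, counit_blockWord G htop, counit_Fmap htop]

theorem IsCoalgEndo.map_one (G : HopfGrading (K := K) (H := H)) {Φ : H →ₗ[K] H}
    (hΦ : IsCoalgEndo Φ) : Φ 1 = 1 := by
  have hε : Coalgebra.counit (R := K) (Φ 1 - 1) = 0 := by
    have := LinearMap.congr_fun hΦ.2 1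
    simp only [LinearMap.comp_apply] at this
    rw [map_sub, this, sub_self]
  have hΔ : Φ 1 ⊗ₜ Φ 1 = Coalgebra.comul (R := K) (Φ 1) := by
    simpa [Algebra.TensorProduct.one_def] using LinearMap.congr_fun hΦ.1 1
  obtain ⟨n, hn⟩ := G.exists_mem_conilFiltration hε
  refine sub_eq_zero.1 (eq_zero_of_reducedComul_eq_tmul hn ?_)
  rw [map_sub, reducedComul_one, reducedComul_apply, ← hΔ, TensorProduct.sub_tmul,
    TensorProduct.tmul_sub, TensorProduct.tmul_sub]
  abel

theorem exists_eq_blockWord (G : HopfGrading (K := K) (H := H)) (htop : IsNaturalGrowth top)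
    {Φ : H →ₗ[K] H} (hΦ : IsCoalgEndo Φ) :
    ∃ us : (m : ℕ) → (PTP K H m : Type u) →ₗ[K] Prim K H,
      ∀ n p a, Φ (Fmap top n (segT p a n)) = blockWord us top p a n := by
  let g : (n : ℕ) → (PTP K H n : Type u) →ₗ[K] Prim K H :=
    Pi.single 0 (LinearMap.id : Prim K H →ₗ[K] Prim K H)
  have hg0 : g 0 = (LinearMap.id : Prim K H →ₗ[K] Prim K H) := Pi.single_eq_same _ _
  have hg (n : ℕ) : g (n + 1) = 0 := Pi.single_eq_of_ne n.succ_ne_zero _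
  obtain ⟨π, -, hπ⟩ := exists_linearMap_extending htop 0 g
  have hπp (q : Prim K H) : π q = q := (hπ 0 q).trans (LinearMap.congr_fun hg0 q)
  have hπtop {x : H} (hx : Coalgebra.counit (R := K) x = 0) (q : Prim K H) : π (top x q) = 0 := by
    rw [counit_eq_zero_iff_mem_iSup_range G htop] at hx
    refine (iSup_le ?_ : _ ≤ LinearMap.ker (π ∘ₗ top.flip q)) hx
    rintro n _ ⟨t, rfl⟩
    exact (hπ (n + 1) (t ⊗ₜ[K] q)).trans (LinearMap.congr_fun (hg n) _)
  let us (n : ℕ) : (PTP K H n : Type u) →ₗ[K] Prim K H := π ∘ₗ Φ ∘ₗ Fmap top n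
  refine ⟨us, fun n ↦ ?_⟩
  induction n using Nat.strong_induction_on with
  | _ n ih =>
  intro p a
  have hD : Φ (Fmap top n (segT p a n)) - blockWord us top p a n ∈ Prim K H := by
    rw [mem_Prim, map_sub, ← (map_reducedComul_iff (hΦ.map_one G) _).2
      (LinearMap.congr_fun hΦ.1 _), reducedComul_Fmap_segT htop, map_sum,
      reducedComul_blockWord htop, sub_eq_zero]
    refine Finset.sum_congr rfl fun k hk ↦ ?_
    have := Finset.mem_range.1 hk
    rw [TensorProduct.map_tmul, ih _ (by omega), ih _ (by omega)]
  have hπW : π (blockWord us top p a n) = us n (segT p a n) := by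
    rw [blockWord_eq, map_add, map_sum, hπp, Finset.sum_eq_zero, add_zero]
    exact fun j _ ↦ hπtop (counit_blockWord G htop us p _ _) _
  have hzero : π (Φ (Fmap top n (segT p a n)) - blockWord us top p a n) = 0 := by
    rw [map_sub, hπW]
    exact sub_self _
  have := hπp ⟨_, hD⟩
  rw [hzero] at this
  exact sub_eq_zero.1 (congrArg Subtype.val this).symm

theorem phiEqns_of_eq_blockWord {Φ : H →ₗ[K] H}
    {us : (m : ℕ) → (PTP K H m : Type u) →ₗ[K] Prim K H} (h1 : Φ 1 = 1)
    (h : ∀ n p a, Φ (Fmap top n (segT p a n)) = blockWord us top p a n) : PhiEqns top us Φ := by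
  refine ⟨h1, fun n p ↦ ?_⟩
  rw [h, blockWord]
  simp only [ofFn_composition_eq_blockVals]

end Endomorphisms


theorem coalgebra_endomorphism_classification {K : Type u} [Field K] [CharZero K]
    {H : Type u} [Ring H] [HopfAlgebra K H]
    (G : HopfGrading (K := K) (H := H))
    (top : H →ₗ[K] H →ₗ[K] H) (htop : IsNaturalGrowth top) :
    -- every family (u_i) defines a coalgebra endomorphism Φ_{(u_i)}
    (∀ us : (m : ℕ) → (PTP K H m : Type u) →ₗ[K] Prim K H,
      ∃ Φ : H →ₗ[K] H, PhiEqns top us Φ ∧ IsCoalgEndo Φ) ∧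
    -- conversely, every coalgebra endomorphism is of the form Φ_{(u_i)}
    (∀ Φ : H →ₗ[K] H, IsCoalgEndo Φ →
      ∃ us : (m : ℕ) → (PTP K H m : Type u) →ₗ[K] Prim K H, PhiEqns top us Φ) := by
  refine ⟨fun us ↦ ?_, fun Φ hΦ ↦ ?_⟩
  · obtain ⟨Φ, h1, hW, hΦ⟩ := exists_isCoalgEndo_blockWord G htop us
    exact ⟨Φ, phiEqns_of_eq_blockWord h1 hW, hΦ⟩
  · obtain ⟨us, h⟩ := exists_eq_blockWord G htop hΦ
    exact ⟨us, phiEqns_of_eq_blockWord (hΦ.map_one G) h⟩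
end

section
/- Let C be a set, H_GL = (OF^C, ∗, Δ_sh) the planar Grossman–Larson Hopf algebra and T(PT^C) = (OF^C, ·, Δ_sh) the tensor Hopf algebra over planar rooted trees (concatenation product and deshuffle coproduct). The linear map φ: H_GL → T(PT^C) determined by φ(τ) = τ for every planar rooted tree τ and φ(ω_1 ∗ ω_2) = φ(ω_1) · φ(ω_2) is well defined and is a Hopf algebra isomorphism. -/
/-!
STATEMENT 17: Let C be a set, H_GL = (OF^C, ∗, Δ_sh) the planar Grossman–Larson Hopf
algebra and T(PT^C) = (OF^C, ·, Δ_sh) the tensor Hopf algebra over planar rooted trees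
(concatenation product and deshuffle coproduct).  The linear map φ : H_GL → T(PT^C)
determined by φ(τ) = τ for every planar rooted tree τ and
φ(ω₁ ∗ ω₂) = φ(ω₁) · φ(ω₂) is well defined and is a Hopf algebra isomorphism.
-/

open TensorProduct

/-- Planar rooted forests with vertices decorated by `C`:
`nil` is the empty forest and `cons a c r` is the forest whose first (leftmost) tree
has root decorated by `a` with (ordered) children forest `c`, followed by the
forest `r`. -/
inductive PForest (C : Type*) : Type _
  | nil : PForest C
  | cons : C → PForest C → PForest C → PForest C

namespace PForest

variable {C : Type*}

/-- Concatenation of ordered forests. -/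
def append : PForest C → PForest C → PForest C
  | .nil, g => g
  | .cons a c r, g => .cons a c (r.append g)

/-- Number of vertices of a forest. -/
def size : PForest C → ℕ
  | .nil => 0
  | .cons _ c r => 1 + c.size + r.size

end PForest

section LinearSpan

variable (K : Type*) [Field K] (C : Type*)

/-- The vector space `OF^C` of (formal linear combinations of) ordered forests,
with the forests as a basis. -/
def OForest : Type _ := PForest C →₀ K

noncomputable instance : AddCommGroup (OForest K C) :=
  inferInstanceAs (AddCommGroup (PForest C →₀ K))

noncomputable instance : Module K (OForest K C) :=
  inferInstanceAs (Module K (PForest C →₀ K))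

variable {K C}

/-- The basis vector of a forest. -/
noncomputable def fof (f : PForest C) : OForest K C :=
  (Finsupp.single f 1 : PForest C →₀ K)

variable (K) in
/-- Linear extension of a map defined on basis forests. -/
noncomputable def liftF {M : Type*} [AddCommGroup M] [Module K M]
    (h : PForest C → M) : OForest K C →ₗ[K] M :=
  (Finsupp.lsum K fun f => LinearMap.toSpanSingleton K M (h f) :
    (PForest C →₀ K) →ₗ[K] M)

variable (K) in
/-- Bilinear extension of a map defined on pairs of basis forests. -/
noncomputable def liftF2 {M : Type*} [AddCommGroup M] [Module K M]
    (h : PForest C → PForest C → M) :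
    OForest K C →ₗ[K] OForest K C →ₗ[K] M :=
  liftF K fun f => liftF K (h f)

/-- The concatenation product `·` on `OF^C`. -/
noncomputable def conPr : OForest K C →ₗ[K] OForest K C →ₗ[K] OForest K C :=
  liftF2 K fun f g => fof (f.append g)

end LinearSpan

section Unshuffle

variable {K : Type*} [Field K] {C : Type*}

/-- All ways of splitting the list of trees of an ordered forest into two
complementary subsequences. -/
def unshuffles : PForest C → List (PForest C × PForest C)
  | .nil => [(.nil, .nil)]
  | .cons a c r =>
      ((unshuffles r).map fun p => (PForest.cons a c p.1, p.2)) ++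
        ((unshuffles r).map fun p => (p.1, PForest.cons a c p.2))

/-- The unshuffle (deshuffle) coproduct `Δ_sh` on `OF^C`. -/
noncomputable def deltaSh : OForest K C →ₗ[K] OForest K C ⊗[K] OForest K C :=
  liftF (M := OForest K C ⊗[K] OForest K C) K fun f =>
    ((unshuffles f).map fun p => fof p.1 ⊗ₜ[K] fof p.2).sum

/-- The counit of `OF^C` (coefficient of the empty forest). -/
noncomputable def counitF : OForest K C →ₗ[K] K :=
  liftF K fun f => match f with | .nil => (1 : K) | _ => 0

/-- Left grafting of all the roots of a forest `w` onto the vertices of a target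
forest: the sum over all ways of distributing the trees of `w` among the vertices of
the target, the trees attached to a vertex being inserted leftmost (as a block, in
their original order) before the existing subtrees of that vertex. -/
noncomputable def graftF : PForest C → PForest C → OForest K C
  | .nil, .nil => fof .nil
  | .cons _ _ _, .nil => 0
  | w, .cons a c r =>
      ((unshuffles w).map fun uv =>
        ((unshuffles uv.1).map fun gd =>
          (liftF2 K fun f f' => fof (PForest.cons a (gd.1.append f) f'))
            (graftF gd.2 c) (graftF uv.2 r)).sum).sum
  termination_by _w f => sizeOf f

/-- The planar Grossman–Larson product `A ∗ B = A₍₁₎ · (A₍₂₎ ⊳ B)` on `OF^C`. -/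
noncomputable def glPr : OForest K C →ₗ[K] OForest K C →ₗ[K] OForest K C :=
  liftF2 K fun f g =>
    ((unshuffles f).map fun p => conPr (fof p.1) (graftF p.2 g)).sum

end Unshuffle

section LinearSpan

variable {K : Type*} [Field K] {C : Type*}

@[simp]
theorem liftF_fof {M : Type*} [AddCommGroup M] [Module K M] (h : PForest C → M)
    (f : PForest C) : liftF K h (fof f) = h f := by
  simp only [liftF, fof]
  exact (Finsupp.lsum_single K _ f 1).trans (by simp)

@[simp]
theorem liftF2_fof_fof {M : Type*} [AddCommGroup M] [Module K M]
    (h : PForest C → PForest C → M) (f g : PForest C) :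
    liftF2 K h (fof f) (fof g) = h f g := by
  simp [liftF2]

theorem OForest.span_fof : Submodule.span K (Set.range (fof : PForest C → OForest K C)) = ⊤ :=
  (Finsupp.basisSingleOne (R := K) (ι := PForest C)).span_eq ▸ by
    congr 2

theorem OForest.hom_ext {M : Type*} [AddCommGroup M] [Module K M]
    {f g : OForest K C →ₗ[K] M} (h : ∀ w, f (fof w) = g (fof w)) : f = g :=
  LinearMap.ext_on_range OForest.span_fof h

theorem OForest.induction {p : OForest K C → Prop} (x : OForest K C)
    (basis : ∀ w, p (fof w)) (zero : p 0)
    (add : ∀ x y, p x → p y → p (x + y)) (smul : ∀ (a : K) x, p x → p (a • x)) : p x := by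
  have hx : x ∈ Submodule.span K (Set.range (fof : PForest C → OForest K C)) :=
    (OForest.span_fof (K := K) (C := C)).symm ▸ Submodule.mem_top
  induction hx using Submodule.span_induction with
  | mem x hx => obtain ⟨w, rfl⟩ := hx; exact basis w
  | zero => exact zero
  | add x y _ _ hx hy => exact add x y hx hy
  | smul a x _ hx => exact smul a x hx

/-- The bilinear map sending `c, r` to the forest whose first tree has root decorated by `a` and
children `c`, followed by `r`. -/
noncomputable def node (a : C) : OForest K C →ₗ[K] OForest K C →ₗ[K] OForest K C :=
  liftF2 K fun c r => fof (PForest.cons a c r)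

/-- The tree with root decorated by `a` and children forest `d`. -/
noncomputable def tree (a : C) (d : PForest C) : OForest K C := fof (PForest.cons a d .nil)

theorem node_fof_fof (a : C) (c r : PForest C) :
    node a (fof c) (fof r) = (fof (PForest.cons a c r) : OForest K C) := by
  simp [node]

@[simp]
theorem conPr_fof_fof (f g : PForest C) :
    conPr (fof f) (fof g) = (fof (f.append g) : OForest K C) := by
  simp [conPr]

@[simp]
theorem conPr_nil_left (x : OForest K C) : conPr (fof PForest.nil) x = x :=
  LinearMap.congr_fun (g := LinearMap.id) (OForest.hom_ext fun w => by simp [PForest.append]) x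

theorem conPr_node (a : C) (c r x : OForest K C) :
    conPr (node a c r) x = node a c (conPr r x) := by
  induction c using OForest.induction with
  | zero => simp
  | add y z hy hz => simp [hy, hz]
  | smul k y hy => simp [hy]
  | basis c =>
    induction r using OForest.induction with
    | zero => simp
    | add y z hy hz => simp [hy, hz]
    | smul k y hy => simp [hy]
    | basis r =>
      induction x using OForest.induction with
      | zero => simp
      | add y z hy hz => simp only [map_add, hy, hz]
      | smul k y hy => simp only [map_smul, hy]
      | basis x => simp [node_fof_fof, PForest.append]

end LinearSpan

section Grafting

variable {K : Type*} [Field K] {C : Type*}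

/-- The linear extension of left grafting. -/
noncomputable def graft : OForest K C →ₗ[K] OForest K C →ₗ[K] OForest K C :=
  liftF2 K graftF

@[simp]
theorem graft_fof_fof (f g : PForest C) : graft (fof f) (fof g) = (graftF f g : OForest K C) := by
  simp [graft]

@[simp]
theorem counitF_nil : counitF (fof PForest.nil : OForest K C) = 1 := by
  simp [counitF]

@[simp]
theorem counitF_node (a : C) (c r : OForest K C) : counitF (node a c r) = 0 := by
  induction c using OForest.induction with
  | zero => simp
  | add y z hy hz => simp [hy, hz]
  | smul k y hy => simp [hy]
  | basis c =>
    induction r using OForest.induction with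
    | zero => simp
    | add y z hy hz => simp [hy, hz]
    | smul k y hy => simp [hy]
    | basis r => simp [node_fof_fof, counitF]

theorem deltaSh_fof (f : PForest C) :
    deltaSh (fof f : OForest K C) =
      ((unshuffles f).map fun p => fof p.1 ⊗ₜ[K] fof p.2).sum := by
  simp [deltaSh]

@[simp]
theorem deltaSh_nil :
    deltaSh (fof PForest.nil : OForest K C) = fof PForest.nil ⊗ₜ[K] fof PForest.nil := by
  simp [deltaSh_fof, unshuffles]

theorem deltaSh_node (a : C) (c r : OForest K C) :
    deltaSh (node a c r) =
      TensorProduct.map (node a c) .id (deltaSh r) +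
        TensorProduct.map .id (node a c) (deltaSh r) := by
  induction c using OForest.induction with
  | zero => simp
  | add y z hy hz =>
    simp only [map_add, LinearMap.add_apply, hy, hz, TensorProduct.map_add_left,
      TensorProduct.map_add_right]
    abel
  | smul k y hy =>
    simp [hy, TensorProduct.map_smul_left, TensorProduct.map_smul_right]
  | basis c =>
    induction r using OForest.induction with
    | zero => simp
    | add y z hy hz =>
      simp only [map_add, hy, hz]
      abel
    | smul k y hy => simp [hy]
    | basis r =>
      simp [node_fof_fof, deltaSh_fof, unshuffles, map_list_sum, Function.comp_def]

/-- Pairing the coproduct of a forest with a bilinear map. -/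
theorem lift_deltaSh_fof {M : Type*} [AddCommGroup M] [Module K M]
    (B : OForest K C →ₗ[K] OForest K C →ₗ[K] M) (w : PForest C) :
    TensorProduct.lift B (deltaSh (fof w)) =
      ((unshuffles w).map fun p => B (fof p.1) (fof p.2)).sum := by
  simp [deltaSh_fof, map_list_sum, Function.comp_def]

theorem glPr_eq_lift (w x : OForest K C) :
    glPr w x = TensorProduct.lift (conPr.compl₂ (graft.flip x)) (deltaSh w) := by
  induction w using OForest.induction with
  | zero => simp
  | add y z hy hz => simp [hy, hz]
  | smul k y hy => simp [hy]
  | basis w =>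
    rw [lift_deltaSh_fof]
    induction x using OForest.induction with
    | zero => simp
    | add y z hy hz => simp [hy, hz, List.sum_map_add]
    | smul k y hy => simp [hy, List.smul_sum, Function.comp_def]
    | basis x => simp [glPr]

@[simp]
theorem graft_apply_nil (w : OForest K C) :
    graft w (fof PForest.nil) = counitF w • fof PForest.nil := by
  induction w using OForest.induction with
  | zero => simp
  | add y z hy hz => simp [hy, hz, add_smul]
  | smul k y hy => simp [hy, mul_smul]
  | basis w => cases w <;> simp [graftF, counitF]

theorem graftF_cons (w : PForest C) (a : C) (c r : PForest C) :
    (graftF w (.cons a c r) : OForest K C) =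
      ((unshuffles w).map fun p =>
        node a (glPr (fof p.1) (fof c)) (graft (fof p.2) (fof r))).sum := by
  have key : ∀ (g : PForest C) (x y : OForest K C),
      liftF2 K (fun f f' => (fof (PForest.cons a (g.append f) f') : OForest K C)) x y =
        node a (conPr (fof g) x) y := by
    intro g x y
    induction x using OForest.induction with
    | zero => simp
    | add y z hy hz => simp [hy, hz]
    | smul k y hy => simp [hy]
    | basis x =>
      induction y using OForest.induction with
      | zero => simp
      | add y z hy hz => simp [hy, hz]
      | smul k y hy => simp [hy]
      | basis y => simp [node_fof_fof]
  have sum_left : ∀ (l : List (OForest K C)) (y : OForest K C),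
      node a l.sum y = (l.map fun x => node a x y).sum :=
    fun l y => map_list_sum ((node a).flip y) l
  cases w <;>
  · rw [graftF]
    simp [key, glPr, sum_left, Function.comp_def]

theorem graft_node (w : OForest K C) (a : C) (c r : OForest K C) :
    graft w (node a c r) =
      TensorProduct.lift ((node a).compl₁₂ (glPr.flip c) (graft.flip r)) (deltaSh w) := by
  induction w using OForest.induction with
  | zero => simp
  | add y z hy hz => simp [hy, hz]
  | smul k y hy => simp [hy]
  | basis w =>
    rw [lift_deltaSh_fof]
    induction c using OForest.induction with
    | zero => simp
    | add y z hy hz => simp [hy, hz, List.sum_map_add]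
    | smul k y hy => simp [hy, List.smul_sum, Function.comp_def]
    | basis c =>
      induction r using OForest.induction with
      | zero => simp
      | add y z hy hz => simp [hy, hz, List.sum_map_add]
      | smul k y hy => simp [hy, List.smul_sum, Function.comp_def]
      | basis r => simp [node_fof_fof, graftF_cons]

end Grafting

section Trees

variable {K : Type*} [Field K] {C : Type*}

theorem tree_eq_node (a : C) (d : PForest C) :
    (tree a d : OForest K C) = node a (fof d) (fof .nil) := by
  simp [tree, node_fof_fof]

theorem deltaSh_tree (a : C) (d : PForest C) :
    deltaSh (tree a d : OForest K C) =
      tree a d ⊗ₜ[K] fof PForest.nil + fof PForest.nil ⊗ₜ[K] tree a d := by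
  simp [tree_eq_node, deltaSh_node]

theorem graft_nil_and_glPr_nil (f : PForest C) :
    graft (fof PForest.nil) (fof f) = (fof f : OForest K C) ∧
      glPr (fof PForest.nil) (fof f) = (fof f : OForest K C) := by
  induction f with
  | nil => simp [glPr_eq_lift, PForest.append]
  | cons a c r hc hr =>
    rw [glPr_eq_lift, ← node_fof_fof a c r]
    simp [graft_node, hc.2, hr.1]

@[simp]
theorem graft_nil (x : OForest K C) : graft (fof PForest.nil) x = x :=
  LinearMap.congr_fun (g := LinearMap.id)
    (OForest.hom_ext fun w => (graft_nil_and_glPr_nil w).1) x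

@[simp]
theorem glPr_nil (x : OForest K C) : glPr (fof PForest.nil) x = x :=
  LinearMap.congr_fun (g := LinearMap.id)
    (OForest.hom_ext fun w => (graft_nil_and_glPr_nil w).2) x

theorem conPr_tree (a : C) (d : PForest C) (x : OForest K C) :
    conPr (tree a d) x = node a (fof d) x := by
  rw [tree_eq_node, conPr_node, conPr_nil_left]

@[simp]
theorem counitF_tree (a : C) (d : PForest C) : counitF (tree a d : OForest K C) = 0 := by
  simp [tree_eq_node]

theorem graft_tree_nil (a : C) (d : PForest C) :
    graft (tree a d) (fof PForest.nil) = (0 : OForest K C) := by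
  simp

theorem glPr_tree (a : C) (d : PForest C) (x : OForest K C) :
    glPr (tree a d) x = node a (fof d) x + graft (tree a d) x := by
  simp [glPr_eq_lift, deltaSh_tree, conPr_tree]

theorem graft_tree_node (a : C) (d : PForest C) (b : C) (c r : OForest K C) :
    graft (tree a d) (node b c r) =
      node b (glPr (tree a d) c) r + node b c (graft (tree a d) r) := by
  simp [graft_node, deltaSh_tree]

theorem graft_tree_conPr (a : C) (d : PForest C) (x y : OForest K C) :
    graft (tree a d) (conPr x y) =
      conPr (graft (tree a d) x) y + conPr x (graft (tree a d) y) := by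
  induction x using OForest.induction with
  | zero => simp
  | add x z hx hz => simp only [map_add, LinearMap.add_apply, hx, hz]; abel
  | smul k x hx => simp [hx]
  | basis f =>
    induction f with
    | nil => simp
    | cons b c r _ hr =>
      simp only [← node_fof_fof b c r, conPr_node, graft_tree_node, map_add,
        LinearMap.add_apply, hr]
      abel

theorem deltaSh_graft_tree (a : C) (d : PForest C) (x : OForest K C) :
    deltaSh (graft (tree a d) x) =
      TensorProduct.map (graft (tree a d)) .id (deltaSh x) +
        TensorProduct.map .id (graft (tree a d)) (deltaSh x) := by
  induction x using OForest.induction with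
  | zero => simp
  | add x z hx hz => simp only [map_add, hx, hz]; abel
  | smul k x hx => simp [hx]
  | basis f =>
    induction f with
    | nil => simp
    | cons b c r _ hr =>
      have comp : graft (tree a d) ∘ₗ node b (fof c : OForest K C) =
          node b (glPr (tree a d) (fof c)) +
            node b (fof c) ∘ₗ (graft (tree a d) : OForest K C →ₗ[K] OForest K C) :=
        LinearMap.ext fun y => graft_tree_node a d b (fof c) y
      simp only [← node_fof_fof b c r, graft_tree_node, map_add, deltaSh_node, hr,
        TensorProduct.map_map, comp, LinearMap.id_comp,
        LinearMap.comp_id, TensorProduct.map_add_left, TensorProduct.map_add_right,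
        LinearMap.add_apply]
      abel

theorem deltaSh_glPr_tree (a : C) (d : PForest C) (x : OForest K C) :
    deltaSh (glPr (tree a d) x) =
      TensorProduct.map (glPr (tree a d)) .id (deltaSh x) +
        TensorProduct.map .id (glPr (tree a d)) (deltaSh x) := by
  have h : glPr (tree a d) = node a (fof d) + (graft (tree a d) : OForest K C →ₗ[K] _) :=
    LinearMap.ext (glPr_tree a d)
  simp only [h, LinearMap.add_apply, map_add, deltaSh_node, deltaSh_graft_tree,
    TensorProduct.map_add_left, TensorProduct.map_add_right]
  abel

@[simp]
theorem counitF_graft_tree (a : C) (d : PForest C) (x : OForest K C) :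
    counitF (graft (tree a d) x) = 0 := by
  induction x using OForest.induction with
  | zero => simp
  | add x z hx hz => simp [hx, hz]
  | smul k x hx => simp [hx]
  | basis f =>
    cases f with
    | nil => simp
    | cons b c r => simp [← node_fof_fof b c r, graft_tree_node]

@[simp]
theorem counitF_glPr_tree (a : C) (d : PForest C) (x : OForest K C) :
    counitF (glPr (tree a d) x) = 0 := by
  simp [glPr_tree]

/-- Associativity of `∗` in `τ ∗ x ∗ y` follows from `(τ ∗ w) ⊳ y = τ ⊳ (w ⊳ y)`. -/
theorem glPr_assoc_of_graft (a : C) (d : PForest C) (y : OForest K C)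
    (h : ∀ w, graft (glPr (tree a d) w) y = graft (tree a d) (graft w y)) (x : OForest K C) :
    glPr (glPr (tree a d) x) y = glPr (tree a d) (glPr x y) := by
  rw [glPr_eq_lift _ y, deltaSh_glPr_tree, glPr_eq_lift x y, map_add]
  generalize deltaSh x = t
  induction t using TensorProduct.induction_on with
  | zero => simp
  | add t s ht hs =>
    simp only [map_add, ← hs, ← ht]
    abel
  | tmul u v =>
    simp only [TensorProduct.map_tmul, TensorProduct.lift.tmul, LinearMap.compl₂_apply,
      LinearMap.flip_apply, LinearMap.id_apply, h]
    simp only [glPr_tree, graft_tree_conPr, map_add, LinearMap.add_apply, conPr_node]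
    abel

theorem graft_glPr_tree (a : C) (d : PForest C) (x y : OForest K C) :
    graft (glPr (tree a d) x) y = graft (tree a d) (graft x y) := by
  induction y using OForest.induction generalizing x with
  | zero => simp
  | add y z hy hz => simp [hy, hz]
  | smul k y hy => simp [hy]
  | basis f =>
    induction f generalizing x with
    | nil => simp
    | cons b c r hc hr =>
      have hc' := glPr_assoc_of_graft a d (fof c) hc
      rw [← node_fof_fof b c r, graft_node, deltaSh_glPr_tree, graft_node, map_add]
      generalize deltaSh x = t
      induction t using TensorProduct.induction_on with
      | zero => simp
      | add t s ht hs =>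
        simp only [map_add, ← hs, ← ht]
        abel
      | tmul u v => simp [hc', hr, graft_tree_node]

theorem glPr_tree_assoc (a : C) (d : PForest C) (x y : OForest K C) :
    glPr (glPr (tree a d) x) y = glPr (tree a d) (glPr x y) :=
  glPr_assoc_of_graft a d y (fun w => graft_glPr_tree a d w y) x

end Trees

section Iso

variable {K : Type*} [Field K] {C : Type*}

/-- The Grossman–Larson product of the trees of a forest. -/
noncomputable def glProd : PForest C → OForest K C
  | .nil => fof .nil
  | .cons a d r => glPr (tree a d) (glProd r)

/-- The linear map from the tensor algebra sending `τ₁ ⋯ τₙ` to `τ₁ ∗ ⋯ ∗ τₙ`. -/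
noncomputable def ofTensor : OForest K C →ₗ[K] OForest K C := liftF K glProd

@[simp]
theorem ofTensor_nil : ofTensor (fof PForest.nil) = (fof .nil : OForest K C) := by
  simp [ofTensor, glProd]

theorem ofTensor_node (a : C) (d : PForest C) (x : OForest K C) :
    ofTensor (node a (fof d) x) = glPr (tree a d) (ofTensor x) := by
  have h : ofTensor ∘ₗ node a (fof d) = glPr (tree a d) ∘ₗ (ofTensor : OForest K C →ₗ[K] _) :=
    OForest.hom_ext fun w => by simp [ofTensor, node_fof_fof, glProd]
  exact LinearMap.congr_fun h x

theorem ofTensor_tree (a : C) (d : PForest C) :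
    ofTensor (tree a d) = (tree a d : OForest K C) := by
  rw [tree_eq_node, ofTensor_node, ofTensor_nil, glPr_tree, graft_tree_nil, add_zero]

theorem ofTensor_conPr (x y : OForest K C) :
    ofTensor (conPr x y) = glPr (ofTensor x) (ofTensor y) := by
  induction x using OForest.induction with
  | zero => simp
  | add x z hx hz => simp [hx, hz]
  | smul k x hx => simp [hx]
  | basis f =>
    induction f with
    | nil => simp
    | cons a d r _ hr =>
      rw [← node_fof_fof, conPr_node, ofTensor_node, ofTensor_node, hr, glPr_tree_assoc]

theorem deltaSh_ofTensor (x : OForest K C) :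
    deltaSh (ofTensor x) = TensorProduct.map ofTensor ofTensor (deltaSh x) := by
  induction x using OForest.induction with
  | zero => simp
  | add x z hx hz => simp [hx, hz]
  | smul k x hx => simp [hx]
  | basis f =>
    induction f with
    | nil => simp
    | cons a d r _ hr =>
      have comp : ofTensor ∘ₗ node a (fof d) =
          glPr (tree a d) ∘ₗ (ofTensor : OForest K C →ₗ[K] _) :=
        LinearMap.ext (ofTensor_node a d)
      simp only [← node_fof_fof a d r, ofTensor_node, deltaSh_glPr_tree, deltaSh_node, hr,
        map_add]
      simp only [TensorProduct.map_map, comp, LinearMap.id_comp, LinearMap.comp_id]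

theorem counitF_ofTensor (x : OForest K C) : counitF (ofTensor x) = counitF x := by
  have h : counitF ∘ₗ ofTensor = (counitF : OForest K C →ₗ[K] K) :=
    OForest.hom_ext fun w => by
      cases w with
      | nil => simp
      | cons a d r => simp [← node_fof_fof a d r, ofTensor_node]
  exact LinearMap.congr_fun h x

/-- The number of trees of a forest. -/
def PForest.length : PForest C → ℕ
  | .nil => 0
  | .cons _ _ r => r.length + 1

variable (K C) in
/-- The span of the forests with fewer than `n` trees. -/
noncomputable def lengthFiltration (n : ℕ) : Submodule K (OForest K C) :=
  Submodule.span K (fof '' {f | f.length < n})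

theorem fof_mem_lengthFiltration {n : ℕ} {f : PForest C} (h : f.length < n) :
    fof f ∈ lengthFiltration K C n :=
  Submodule.subset_span ⟨f, h, rfl⟩

theorem lengthFiltration_mono : Monotone (lengthFiltration K C) := fun _ _ h =>
  Submodule.span_mono (Set.image_mono fun _ hf => lt_of_lt_of_le hf h)

theorem mem_lengthFiltration_of_basis {N : Submodule K (OForest K C)} {n : ℕ}
    {g : OForest K C →ₗ[K] OForest K C} (h : ∀ f : PForest C, f.length < n → g (fof f) ∈ N)
    {x : OForest K C} (hx : x ∈ lengthFiltration K C n) : g x ∈ N := by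
  have : lengthFiltration K C n ≤ N.comap g :=
    Submodule.span_le.2 (by rintro _ ⟨f, hf, rfl⟩; exact h f hf)
  exact this hx

theorem exists_mem_lengthFiltration (x : OForest K C) : ∃ n, x ∈ lengthFiltration K C n := by
  induction x using OForest.induction with
  | basis w => exact ⟨w.length + 1, fof_mem_lengthFiltration (Nat.lt_succ_self _)⟩
  | zero => exact ⟨0, zero_mem _⟩
  | add x y hx hy =>
    obtain ⟨m, hm⟩ := hx
    obtain ⟨n, hn⟩ := hy
    exact ⟨max m n, add_mem (lengthFiltration_mono (le_max_left _ _) hm)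
      (lengthFiltration_mono (le_max_right _ _) hn)⟩
  | smul a x hx =>
    obtain ⟨n, hn⟩ := hx
    exact ⟨n, Submodule.smul_mem _ a hn⟩

theorem node_mem_lengthFiltration (a : C) (c : OForest K C) {x : OForest K C} {n : ℕ}
    (hx : x ∈ lengthFiltration K C n) : node a c x ∈ lengthFiltration K C (n + 1) := by
  refine mem_lengthFiltration_of_basis (fun f hf => ?_) hx
  induction c using OForest.induction with
  | basis w => simpa [node_fof_fof] using fof_mem_lengthFiltration (Nat.succ_lt_succ hf)
  | zero => simp
  | add y z hy hz => simpa using add_mem hy hz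
  | smul k y hy => simpa using Submodule.smul_mem _ k hy

theorem graft_tree_mem_lengthFiltration (a : C) (d : PForest C) {x : OForest K C} {n : ℕ}
    (hx : x ∈ lengthFiltration K C n) : graft (tree a d) x ∈ lengthFiltration K C n := by
  refine mem_lengthFiltration_of_basis (fun f hf => ?_) hx
  clear hx
  induction f generalizing n with
  | nil => simp
  | cons b c r _ hr =>
    obtain _ | n := n
    · exact absurd hf (Nat.not_lt_zero _)
    have hr' : r.length < n := Nat.lt_of_succ_lt_succ hf
    rw [← node_fof_fof, graft_tree_node]
    exact add_mem (node_mem_lengthFiltration b _ (fof_mem_lengthFiltration hr'))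
      (node_mem_lengthFiltration b _ (hr hr'))

theorem ofTensor_fof_sub_mem (f : PForest C) :
    ofTensor (fof f) - fof f ∈ lengthFiltration K C f.length := by
  induction f with
  | nil => simp
  | cons a d r _ hr =>
    have hψ : ofTensor (fof r) ∈ lengthFiltration K C (r.length + 1) := by
      have h := add_mem (lengthFiltration_mono (Nat.le_succ _) hr)
        (fof_mem_lengthFiltration (K := K) (Nat.lt_succ_self r.length))
      rwa [sub_add_cancel] at h
    rw [← node_fof_fof, ofTensor_node, glPr_tree, add_sub_right_comm, ← map_sub]
    exact add_mem (node_mem_lengthFiltration a _ hr) (graft_tree_mem_lengthFiltration a d hψ)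

theorem ofTensor_sub_mem {n : ℕ} {x : OForest K C} (hx : x ∈ lengthFiltration K C (n + 1)) :
    ofTensor x - x ∈ lengthFiltration K C n :=
  mem_lengthFiltration_of_basis (g := ofTensor - LinearMap.id)
    (fun f hf => lengthFiltration_mono (Nat.le_of_lt_succ hf) (ofTensor_fof_sub_mem f)) hx

theorem lengthFiltration_zero : lengthFiltration K C 0 = ⊥ := by
  simp [lengthFiltration]

theorem ofTensor_bijective : Function.Bijective (ofTensor : OForest K C →ₗ[K] OForest K C) := by
  constructor
  · refine (injective_iff_map_eq_zero _).2 fun x hx => ?_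
    obtain ⟨n, hn⟩ := exists_mem_lengthFiltration x
    induction n with
    | zero => simpa [lengthFiltration_zero] using hn
    | succ n ih => exact ih (by simpa [hx] using ofTensor_sub_mem hn)
  · intro x
    obtain ⟨n, hn⟩ := exists_mem_lengthFiltration x
    induction n generalizing x with
    | zero => exact ⟨0, by simpa [lengthFiltration_zero, eq_comm] using hn⟩
    | succ n ih =>
      obtain ⟨y, hy⟩ := ih _ (ofTensor_sub_mem hn)
      exact ⟨x - y, by rw [map_sub, hy, sub_sub_cancel]⟩

end Iso

theorem grossmanLarson_iso_tensor {K : Type*} [Field K] [CharZero K] {C : Type*} :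
    ∃ φ : OForest K C →ₗ[K] OForest K C,
      -- φ fixes every planar rooted tree
      (∀ (a : C) (c : PForest C),
        φ (fof (PForest.cons a c .nil)) = fof (PForest.cons a c .nil)) ∧
      -- φ is an algebra morphism from the Grossman–Larson product to concatenation
      φ (fof PForest.nil) = fof PForest.nil ∧
      (∀ x y : OForest K C, φ (glPr x y) = conPr (φ x) (φ y)) ∧
      -- φ is bijective
      Function.Bijective φ ∧
      -- φ is a coalgebra morphism (both sides carry the deshuffle coproduct Δ_sh)
      (TensorProduct.map φ φ) ∘ₗ deltaSh = deltaSh ∘ₗ φ ∧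
      counitF ∘ₗ φ = counitF := by
  let e : OForest K C ≃ₗ[K] OForest K C := LinearEquiv.ofBijective ofTensor ofTensor_bijective
  have he : ∀ x, e x = ofTensor x := fun _ => rfl
  have he' : (e : OForest K C →ₗ[K] OForest K C) = ofTensor := rfl
  refine ⟨e.symm, fun a c => ?_, ?_, fun x y => ?_, e.symm.bijective, ?_, ?_⟩
  · exact e.symm_apply_eq.2 (ofTensor_tree a c).symm
  · exact e.symm_apply_eq.2 ofTensor_nil.symm
  · refine e.symm_apply_eq.2 ?_
    simp only [he, ofTensor_conPr, LinearEquiv.coe_coe]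
    simp only [← he, LinearEquiv.apply_symm_apply]
  · refine LinearMap.ext fun x => ?_
    obtain ⟨y, rfl⟩ := e.surjective x
    simp only [LinearMap.comp_apply, LinearEquiv.coe_coe, LinearEquiv.symm_apply_apply]
    rw [he, deltaSh_ofTensor, ← he', ← LinearMap.comp_apply, ← TensorProduct.map_comp]
    simp
  · refine LinearMap.ext fun x => ?_
    obtain ⟨y, rfl⟩ := e.surjective x
    rw [LinearMap.comp_apply, LinearEquiv.coe_coe, LinearEquiv.symm_apply_apply, he,
      counitF_ofTensor]
end
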